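/- arXiv:2602.03963 — 5 statements merged into one kernel-verified Lean document; each statement's English description precedes it below -/
import Mathlib

section
/- Fix μ ∈ ℝ. Let ψ : Q → ℝ be twice continuously differentiable and set ψ̄ = ψ ∘ Φ. Then for every (u,v) ∈ Q, writing (ū,v̄) = Φ(u,v) = (−1/v, −1/u): ( −∂_u∂_v ψ − μ (v−u)^{−2} ψ )(u,v) = (1/(u²v²)) · ( −∂_ū∂_v̄ ψ̄ − μ (v̄−ū)^{−2} ψ̄ )(ū,v̄). That is, the operator −∂_u∂_v − μ/r² transforms covariantly under the inversion Φ with conformal factor u⁻²v⁻². -/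
open Set

/-- The quadrant `Q = {(u,v) : u < 0 < v}` of null coordinates. -/
def Q : Set (ℝ × ℝ) := {p | p.1 < 0 ∧ 0 < p.2}

/-- The coordinate inversion `Φ(u,v) = (-1/v, -1/u)`. -/
noncomputable def Φ (p : ℝ × ℝ) : ℝ × ℝ := (-1 / p.2, -1 / p.1)

/-- Partial derivative in the first argument. -/
noncomputable def pd1 (f : ℝ × ℝ → ℝ) (p : ℝ × ℝ) : ℝ :=
  deriv (fun x => f (x, p.2)) p.1

/-- Partial derivative in the second argument. -/
noncomputable def pd2 (f : ℝ × ℝ → ℝ) (p : ℝ × ℝ) : ℝ :=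
  deriv (fun y => f (p.1, y)) p.2

lemma Q_open : IsOpen Q :=
  (isOpen_lt continuous_fst continuous_const).inter (isOpen_lt continuous_const continuous_snd)

lemma hasDerivAt_line1 {f : ℝ × ℝ → ℝ} {a b : ℝ} (h : DifferentiableAt ℝ f (a, b)) :
    HasDerivAt (fun x => f (x, b)) (fderiv ℝ f (a, b) (1, 0)) a :=
  HasFDerivAt.comp_hasDerivAt (f := fun x => (x, b)) a h.hasFDerivAt
    ((hasDerivAt_id a).prodMk (hasDerivAt_const a b))

lemma hasDerivAt_line2 {f : ℝ × ℝ → ℝ} {a b : ℝ} (h : DifferentiableAt ℝ f (a, b)) :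
    HasDerivAt (fun y => f (a, y)) (fderiv ℝ f (a, b) (0, 1)) b :=
  HasFDerivAt.comp_hasDerivAt (f := fun y => (a, y)) b h.hasFDerivAt
    ((hasDerivAt_const b a).prodMk (hasDerivAt_id b))

lemma hasDerivAt_neginv {x : ℝ} (hx : x ≠ 0) :
    HasDerivAt (fun x : ℝ => -1 / x) (1 / x ^ 2) x := by
  have := (hasDerivAt_inv hx).const_mul (-1)
  have e : (1 / x ^ 2) = -1 * -(x ^ 2)⁻¹ := by simp
  rw [e]
  simpa only [div_eq_mul_inv] using this

theorem stmt4 (μ : ℝ) (ψ : ℝ × ℝ → ℝ) (hψ : ContDiffOn ℝ 2 ψ Q)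
    (u v : ℝ) (hu : u < 0) (hv : 0 < v) :
    -(pd1 (pd2 ψ) (u, v)) - μ / (v - u) ^ 2 * ψ (u, v) =
      (1 / (u ^ 2 * v ^ 2)) *
        (-(pd1 (pd2 (ψ ∘ Φ)) (-1 / v, -1 / u)) -
          μ / ((-1 / u) - (-1 / v)) ^ 2 * (ψ ∘ Φ) (-1 / v, -1 / u)) := by
  have hC : ∀ p ∈ Q, ContDiffAt ℝ 2 ψ p := fun p hp => hψ.contDiffAt (Q_open.mem_nhds hp)
  have hd : ∀ p ∈ Q, DifferentiableAt ℝ ψ p := fun p hp => (hC p hp).differentiableAt (by norm_num)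
  have hQ : (u, v) ∈ Q := ⟨hu, hv⟩
  have hD : DifferentiableAt ℝ (fderiv ℝ ψ) (u, v) :=
    ((hC _ hQ).fderiv_right (m := 1) (by norm_num)).differentiableAt (by norm_num)
  have hsym : fderiv ℝ (fderiv ℝ ψ) (u, v) (1, 0) (0, 1)
      = fderiv ℝ (fderiv ℝ ψ) (u, v) (0, 1) (1, 0) :=
    ((hC _ hQ).isSymmSndFDerivAt (by simp)) (1, 0) (0, 1)
  have hDw : ∀ w : ℝ × ℝ, HasFDerivAt (fun p => fderiv ℝ ψ p w)
      ((fderiv ℝ (fderiv ℝ ψ) (u, v)).flip w) (u, v) := fun w => by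
    simpa using hD.hasFDerivAt.clm_apply (hasFDerivAt_const w (u, v))
  have hu0 : u ≠ 0 := hu.ne
  have hv0 : v ≠ 0 := hv.ne'
  have h1 : pd1 (pd2 ψ) (u, v) = fderiv ℝ (fderiv ℝ ψ) (u, v) (1, 0) (0, 1) := by
    have key := hasDerivAt_line1 (hDw (0, 1)).differentiableAt
    rw [(hDw (0, 1)).fderiv] at key
    refine (key.congr_of_eventuallyEq ?_).deriv
    filter_upwards [Iio_mem_nhds hu] with x hx
    exact (hasDerivAt_line2 (hd (x, v) ⟨hx, hv⟩)).deriv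
  have h2 : pd1 (pd2 (ψ ∘ Φ)) (-1 / v, -1 / u)
      = u ^ 2 * v ^ 2 * fderiv ℝ (fderiv ℝ ψ) (u, v) (0, 1) (1, 0) := by
    have key := hasDerivAt_line2 (hDw (1, 0)).differentiableAt
    rw [(hDw (1, 0)).fderiv] at key
    have ev : -1 / (-1 / v) = v := by field_simp
    have eu : -1 / (-1 / u) = u := by field_simp
    have hneg : -1 / v < 0 := div_neg_of_neg_of_pos (by norm_num) hv
    have hi := hasDerivAt_neginv hneg.ne
    have key2 := (HasDerivAt.comp_of_eq (-1 / v) key hi ev.symm).const_mul (u ^ 2)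
    have key3 := key2.congr_of_eventuallyEq (f₁ := fun x => pd2 (ψ ∘ Φ) (x, -1 / u)) ?_
    · refine key3.deriv.trans ?_
      simp only [ContinuousLinearMap.flip_apply]
      field_simp
    · filter_upwards [Iio_mem_nhds hneg] with x hx
      have hx' : 0 < -1 / x := div_pos_of_neg_of_neg (by norm_num) hx
      have l := hasDerivAt_line1 (hd (u, -1 / x) ⟨hu, hx'⟩)
      have hpos : -1 / u ≠ 0 := by simp [hu0]
      have l2 := HasDerivAt.comp_of_eq (-1 / u) l (hasDerivAt_neginv hpos) eu.symm
      refine l2.deriv.trans ?_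
      simp only [Function.comp]
      field_simp
  have h3 : (ψ ∘ Φ) (-1 / v, -1 / u) = ψ (u, v) := by
    simp only [Function.comp, Φ]
    congr 2 <;> field_simp
  have h4 : v - u ≠ 0 := by linarith
  have h5 : -1 / u - -1 / v = (v - u) / (- (u * v)) := by field_simp; ring
  rw [h1, h2, h3, h5, hsym]
  field_simp
end

section
/- Let d ≥ 3 be an integer. The function φ(t,r) = 2·arctan( r / ( (−t)·√(d−2) ) ), defined for t < 0 and r > 0, satisfies the 1-corotational wave maps equation: −∂_t² φ + ∂_r² φ + ((d−1)/r) ∂_r φ − ((d−1)/(2r²)) · sin(2φ) = 0 at every point (t,r) with t < 0 and r > 0. -/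
open Set Real

/-- The self-similar Type I blow-up profile for the 1-corotational wave maps
equation: `φ(t,r) = 2 arctan(r / ((-t)·√(d-2)))`. -/
noncomputable def φss (d : ℕ) (p : ℝ × ℝ) : ℝ :=
  2 * Real.arctan (p.2 / ((-p.1) * Real.sqrt ((d : ℝ) - 2)))

lemma φss_pd1 (s : ℝ) (hs : 0 < s) (t r : ℝ) (ht : t < 0) :
    HasDerivAt (fun x => 2 * Real.arctan (r / ((-x) * s))) (2 * r * s / (s ^ 2 * t ^ 2 + r ^ 2)) t := by
  have h0 : -t * s ≠ 0 := (mul_pos (neg_pos.2 ht) hs).ne'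
  have h1 : HasDerivAt (fun x : ℝ => (-x) * s) (-1 * s) t := (hasDerivAt_id' t).neg.mul_const s
  have h2 := (((hasDerivAt_const t r).fun_div h1 h0).arctan).const_mul 2
  refine h2.congr_deriv ?_
  have hD : s ^ 2 * t ^ 2 + r ^ 2 ≠ 0 := by
    have := mul_pos (pow_pos hs 2) (pow_pos (neg_pos.2 ht) 2)
    nlinarith [sq_nonneg r]
  have hD' : t ^ 2 * s ^ 2 + r ^ 2 ≠ 0 := by rwa [mul_comm (t ^ 2)]
  have ht' := ht.ne
  field_simp
  ring

lemma φss_pd2 (s : ℝ) (hs : 0 < s) (t r : ℝ) (ht : t < 0) :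
    HasDerivAt (fun y => 2 * Real.arctan (y / ((-t) * s)))
      (2 * (-t * s) / (s ^ 2 * t ^ 2 + r ^ 2)) r := by
  have h2 := (((hasDerivAt_id' r).div_const (-t * s)).arctan).const_mul 2
  refine h2.congr_deriv ?_
  have hD : s ^ 2 * t ^ 2 + r ^ 2 ≠ 0 := by
    have := mul_pos (pow_pos hs 2) (pow_pos (neg_pos.2 ht) 2)
    nlinarith [sq_nonneg r]
  have hD' : t ^ 2 * s ^ 2 + r ^ 2 ≠ 0 := by rwa [mul_comm (t ^ 2)]
  have ht' := ht.ne
  field_simp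

theorem stmt8 (d : ℕ) (hd : 3 ≤ d) (t r : ℝ) (ht : t < 0) (hr : 0 < r) :
    -(pd1 (pd1 (φss d)) (t, r)) + pd2 (pd2 (φss d)) (t, r) +
        (((d : ℝ) - 1) / r) * pd2 (φss d) (t, r) -
        (((d : ℝ) - 1) / (2 * r ^ 2)) * Real.sin (2 * φss d (t, r)) = 0 := by
  have hd' : (3 : ℝ) ≤ d := by exact_mod_cast hd
  obtain ⟨s, hsdef⟩ : ∃ s, s = Real.sqrt ((d : ℝ) - 2) := ⟨_, rfl⟩
  have hs : 0 < s := by rw [hsdef]; exact Real.sqrt_pos.2 (by linarith)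
  have hs2 : s ^ 2 = (d : ℝ) - 2 := by rw [hsdef]; exact Real.sq_sqrt (by linarith)
  have hdd : (d : ℝ) - 1 = s ^ 2 + 1 := by linarith
  have hD : s ^ 2 * t ^ 2 + r ^ 2 ≠ 0 := by positivity
  have e1 : ∀ x < 0, pd1 (φss d) (x, r) = 2 * r * s / (s ^ 2 * x ^ 2 + r ^ 2) := by
    intro x hx
    simp only [pd1, φss, ← hsdef]
    exact (φss_pd1 s hs x r hx).deriv
  have e2 : ∀ y, pd2 (φss d) (t, y) = 2 * (-t * s) / (s ^ 2 * t ^ 2 + y ^ 2) := by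
    intro y
    simp only [pd2, φss, ← hsdef]
    exact (φss_pd2 s hs t y ht).deriv
  have e11 : pd1 (pd1 (φss d)) (t, r)
      = -(4 * r * s ^ 3 * t) / (s ^ 2 * t ^ 2 + r ^ 2) ^ 2 := by
    have h : (fun x => pd1 (φss d) (x, r)) =ᶠ[nhds t]
        fun x => 2 * r * s / (s ^ 2 * x ^ 2 + r ^ 2) := by
      filter_upwards [Iio_mem_nhds ht] with x hx using e1 x hx
    have h1 := (hasDerivAt_const t (2 * r * s)).fun_div
      (((hasDerivAt_pow 2 t).const_mul (s ^ 2)).add_const (r ^ 2)) hD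
    change deriv (fun x => pd1 (φss d) (x, r)) t = _
    rw [h.deriv_eq, h1.deriv]
    congr 1
    push_cast
    ring
  have e22 : pd2 (pd2 (φss d)) (t, r)
      = (4 * t * s * r) / (s ^ 2 * t ^ 2 + r ^ 2) ^ 2 := by
    have h1 := (hasDerivAt_const r (2 * (-t * s))).fun_div
      ((hasDerivAt_pow 2 r).const_add (s ^ 2 * t ^ 2)) hD
    change deriv (fun y => pd2 (φss d) (t, y)) r = _
    rw [funext e2, h1.deriv]
    congr 1
    push_cast
    ring
  have e3 : Real.sin (2 * φss d (t, r)) =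
      2 * (2 * r * (-t * s) / (s ^ 2 * t ^ 2 + r ^ 2)) *
        ((s ^ 2 * t ^ 2 - r ^ 2) / (s ^ 2 * t ^ 2 + r ^ 2)) := by
    simp only [φss, ← hsdef]
    have ht' := ht.ne
    have hD' : t ^ 2 * s ^ 2 + r ^ 2 ≠ 0 := by rwa [mul_comm (t ^ 2)]
    have hx : 1 + (r / (-t * s)) ^ 2 = (s ^ 2 * t ^ 2 + r ^ 2) / (s ^ 2 * t ^ 2) := by
      field_simp
    have hc := Real.cos_sq_arctan (r / (-t * s))
    have hsn : Real.sin (Real.arctan (r / (-t * s)))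
        = r / (-t * s) * Real.cos (Real.arctan (r / (-t * s))) := by
      rw [← Real.tan_mul_cos (Real.cos_arctan_pos _).ne', Real.tan_arctan]
    rw [hx] at hc
    rw [Real.sin_two_mul, Real.sin_two_mul, Real.cos_two_mul, hsn]
    generalize Real.cos (Real.arctan (r / (-t * s))) = c at *
    have : 2 * (2 * (r / (-t * s) * c) * c) * (2 * c ^ 2 - 1)
        = 4 * (r / (-t * s)) * c ^ 2 * (2 * c ^ 2 - 1) := by ring
    rw [this, hc]
    field_simp
    ring
  rw [e11, e22, e2, e3, hdd]
  field_simp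
  ring
end

section
/- Let d ≥ 3 be an integer. The function F(ρ) = 2·arctan( ρ/√(d−2) ) satisfies, for every ρ > 0, the self-similar profile ODE: (1 − ρ²)·F''(ρ) + ( (d−1)/ρ − 2ρ )·F'(ρ) − ((d−1)/(2ρ²))·sin(2F(ρ)) = 0. -/
theorem stmt9 (d : ℕ) (hd : 3 ≤ d) (ρ : ℝ) (hρ : 0 < ρ) :
    (1 - ρ ^ 2) *
        deriv (deriv (fun s : ℝ => 2 * Real.arctan (s / Real.sqrt ((d : ℝ) - 2)))) ρ +
      (((d : ℝ) - 1) / ρ - 2 * ρ) *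
        deriv (fun s : ℝ => 2 * Real.arctan (s / Real.sqrt ((d : ℝ) - 2))) ρ -
      (((d : ℝ) - 1) / (2 * ρ ^ 2)) *
        Real.sin (2 * (2 * Real.arctan (ρ / Real.sqrt ((d : ℝ) - 2)))) = 0 := by
  have hd' : (3 : ℝ) ≤ (d : ℝ) := by exact_mod_cast hd
  obtain ⟨a, ha⟩ : ∃ a, a = Real.sqrt ((d : ℝ) - 2) := ⟨_, rfl⟩
  have ha0 : 0 < a := by rw [ha]; exact Real.sqrt_pos.mpr (by linarith)
  have ha2 : a ^ 2 = (d : ℝ) - 2 := by rw [ha]; exact Real.sq_sqrt (by linarith)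
  have hD : (d : ℝ) = a ^ 2 + 2 := by linarith
  rw [← ha, hD]
  have hpos : ∀ s : ℝ, a ^ 2 + s ^ 2 ≠ 0 := fun s => by positivity
  have h1 : deriv (fun s : ℝ => 2 * Real.arctan (s / a)) =
      fun s => 2 * a / (a ^ 2 + s ^ 2) := by
    funext s
    have h := ((((hasDerivAt_id s).div_const a).arctan).const_mul 2)
    refine Eq.trans h.deriv ?_
    have := hpos s
    have h3 : 1 + (s / a) ^ 2 ≠ 0 := by positivity
    simp only [id]
    field_simp
  have h2 : deriv (fun s : ℝ => 2 * a / (a ^ 2 + s ^ 2)) ρ =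
      -(4 * a * ρ) / (a ^ 2 + ρ ^ 2) ^ 2 := by
    have h := (hasDerivAt_const ρ (2 * a)).div
      (((hasDerivAt_id ρ).pow 2).const_add (a ^ 2)) (hpos ρ)
    refine Eq.trans h.deriv ?_
    simp
    ring
  have hc : Real.cos (Real.arctan (ρ / a)) ^ 2 = a ^ 2 / (a ^ 2 + ρ ^ 2) := by
    rw [Real.cos_sq_arctan]
    have := hpos ρ
    field_simp
  have hs : Real.sin (Real.arctan (ρ / a)) = ρ / a * Real.cos (Real.arctan (ρ / a)) := by
    have h := Real.tan_mul_cos (Real.cos_arctan_pos (ρ / a)).ne'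
    rw [Real.tan_arctan] at h
    exact h.symm
  have h4 : Real.sin (2 * (2 * Real.arctan (ρ / a))) =
      4 * a * ρ * (a ^ 2 - ρ ^ 2) / (a ^ 2 + ρ ^ 2) ^ 2 := by
    rw [Real.sin_two_mul, Real.sin_two_mul, Real.cos_two_mul, hs]
    have e : ∀ c : ℝ, 2 * (2 * (ρ / a * c) * c) * (2 * c ^ 2 - 1) =
      4 * (ρ / a) * c ^ 2 * (2 * c ^ 2 - 1) := fun c => by ring
    rw [e, hc]
    have := hpos ρ
    field_simp
    ring
  rw [h1, h2, h4]
  have := hpos ρ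
  field_simp
  ring
end

section
/- Let f : (0,1] → ℝ be continuously differentiable, and suppose that A := ∫₀¹ f(s)²/s ds and B := ∫₀¹ s·(f'(s))² ds are both finite. Then for every x ∈ (0,1]: f(x)² ≤ f(1)² + 2·√(A·B). -/
open MeasureTheory

theorem stmt15 (f f' : ℝ → ℝ)
    (hderiv : ∀ x ∈ Set.Ioc (0 : ℝ) 1, HasDerivWithinAt f (f' x) (Set.Ioc 0 1) x)
    (hcont : ContinuousOn f' (Set.Ioc 0 1))
    (hA : IntegrableOn (fun s => f s ^ 2 / s) (Set.Ioc 0 1))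
    (hB : IntegrableOn (fun s => s * f' s ^ 2) (Set.Ioc 0 1))
    (x : ℝ) (hx : x ∈ Set.Ioc (0 : ℝ) 1) :
    f x ^ 2 ≤ f 1 ^ 2 +
      2 * Real.sqrt ((∫ s in Set.Ioc (0 : ℝ) 1, f s ^ 2 / s) *
        (∫ s in Set.Ioc (0 : ℝ) 1, s * f' s ^ 2)) := by
  have hfc : ContinuousOn f (Set.Ioc 0 1) := fun y hy => (hderiv y hy).continuousWithinAt
  have hsub : Set.Icc x 1 ⊆ Set.Ioc (0 : ℝ) 1 := fun y hy => ⟨lt_of_lt_of_le hx.1 hy.1, hy.2⟩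
  have hsub' : Set.Ioc x 1 ⊆ Set.Ioc (0 : ℝ) 1 := Set.Ioc_subset_Icc_self.trans hsub
  have hcc : ContinuousOn (fun s => 2 * f s * f' s) (Set.Icc x 1) :=
    ((continuousOn_const.mul (hfc.mono hsub)).mul (hcont.mono hsub))
  have hint : IntervalIntegrable (fun s => 2 * f s * f' s) volume x 1 :=
    ContinuousOn.intervalIntegrable_of_Icc hx.2 hcc
  have hftc : ∫ s in x..1, 2 * f s * f' s = f 1 ^ 2 - f x ^ 2 := by
    refine intervalIntegral.integral_eq_sub_of_hasDerivAt_of_le (f := fun s => f s ^ 2) hx.2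
      ((hfc.mono hsub).pow 2) ?_ hint
    intro y hy
    have h1 : HasDerivAt f (f' y) y :=
      (hderiv y (hsub (Set.Ioo_subset_Icc_self hy))).hasDerivAt
        (Ioc_mem_nhds (hx.1.trans hy.1) hy.2)
    simpa using h1.fun_pow 2
  rw [intervalIntegral.integral_of_le hx.2] at hftc
  have hint' : IntegrableOn (fun s => 2 * f s * f' s) (Set.Ioc x 1) :=
    (intervalIntegrable_iff_integrableOn_Ioc_of_le hx.2).1 hint
  set A := ∫ s in Set.Ioc (0 : ℝ) 1, f s ^ 2 / s with hAd
  set B := ∫ s in Set.Ioc (0 : ℝ) 1, s * f' s ^ 2 with hBd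
  have key : ∀ t : ℝ, 0 ≤ A * (t * t) + (f 1 ^ 2 - f x ^ 2) * t + B := by
    intro t
    have hG : IntegrableOn (fun s => t ^ 2 * (f s ^ 2 / s) + s * f' s ^ 2) (Set.Ioc 0 1) :=
      (hA.const_mul _).add hB
    have e : ∫ s in Set.Ioc (0 : ℝ) 1, (t ^ 2 * (f s ^ 2 / s) + s * f' s ^ 2)
        = t ^ 2 * A + B := by
      rw [integral_add (hA.const_mul _) hB, integral_const_mul]
    have h1 : ∫ s in Set.Ioc x 1, (t ^ 2 * (f s ^ 2 / s) + s * f' s ^ 2) ≤ t ^ 2 * A + B := by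
      rw [← e]
      refine setIntegral_mono_set hG ?_ (Filter.Eventually.of_forall hsub')
      filter_upwards [ae_restrict_mem measurableSet_Ioc] with s hs
      have := hs.1
      simp only [Pi.zero_apply]
      positivity
    have h2 : ∫ s in Set.Ioc x 1, (-t) * (2 * f s * f' s) ≤
        ∫ s in Set.Ioc x 1, (t ^ 2 * (f s ^ 2 / s) + s * f' s ^ 2) := by
      refine setIntegral_mono_on (hint'.const_mul _) (hG.mono_set hsub') measurableSet_Ioc ?_
      intro s hs
      have hs0 : 0 < s := (hsub' hs).1
      have : t ^ 2 * (f s ^ 2 / s) + s * f' s ^ 2 - (-t) * (2 * f s * f' s)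
          = (t * f s + s * f' s) ^ 2 / s := by
        field_simp
        ring
      have h0 : 0 ≤ (t * f s + s * f' s) ^ 2 / s := by positivity
      linarith
    rw [integral_const_mul, hftc] at h2
    nlinarith
  have hd := discrim_le_zero key
  unfold discrim at hd
  have : (f x ^ 2 - f 1 ^ 2) / 2 ≤ Real.sqrt (A * B) := by
    apply Real.le_sqrt_of_sq_le
    nlinarith
  linarith
end

section
/- For every real a₀ > −1 and every C > 0, there exist δ > 0 and C' > 0 such that: for all real u, v with −1 < u < 0 < v < 1 and every x ∈ ℝ with |x| ≤ C·(v−u)^{a₀}, writing r = v − u, one has (v/r)^{1−δ} · r^{2−δ} · ((−u)/r)^{1−δ} · r^{−a₀} · |x|³ ≤ C' · ( r^{−a₀} · |x| )². -/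
theorem stmt17 (a₀ : ℝ) (ha : -1 < a₀) (C : ℝ) (hC : 0 < C) :
    ∃ δ > (0 : ℝ), ∃ C' > (0 : ℝ), ∀ u v x : ℝ,
      -1 < u → u < 0 → 0 < v → v < 1 → |x| ≤ C * (v - u) ^ a₀ →
      (v / (v - u)) ^ (1 - δ) * (v - u) ^ (2 - δ) * ((-u) / (v - u)) ^ (1 - δ) *
          (v - u) ^ (-a₀) * |x| ^ (3 : ℕ) ≤
        C' * ((v - u) ^ (-a₀) * |x|) ^ (2 : ℕ) := by
  obtain ⟨δ, h0, h1, h2⟩ : ∃ δ : ℝ, 0 < δ ∧ δ ≤ 1 ∧ δ ≤ a₀ + 1 :=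
    ⟨min 1 (a₀ + 1), lt_min one_pos (by linarith), min_le_left _ _, min_le_right _ _⟩
  refine ⟨δ, h0, (2 : ℝ) ^ (2 - δ + a₀ + a₀) * C, by positivity, ?_⟩
  intro u v x hu hu0 hv hv1 hx
  have hr : 0 < v - u := by linarith
  have hA : (v / (v - u)) ^ (1 - δ) ≤ 1 :=
    Real.rpow_le_one (by positivity) ((div_le_one hr).2 (by linarith)) (by linarith)
  have hB : ((-u) / (v - u)) ^ (1 - δ) ≤ 1 :=
    Real.rpow_le_one (div_nonneg (by linarith) hr.le)
      ((div_le_one hr).2 (by linarith)) (by linarith)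
  have hA0 : 0 ≤ (v / (v - u)) ^ (1 - δ) := Real.rpow_nonneg (by positivity) _
  have hB0 : 0 ≤ ((-u) / (v - u)) ^ (1 - δ) :=
    Real.rpow_nonneg (div_nonneg (by linarith) hr.le) _
  have hE : (v - u) ^ (2 - δ + a₀ + a₀) ≤ (2 : ℝ) ^ (2 - δ + a₀ + a₀) :=
    Real.rpow_le_rpow hr.le (by linarith) (by linarith)
  rw [Real.rpow_add hr, Real.rpow_add hr] at hE
  rw [Real.rpow_neg hr.le]
  have hs : 0 < (v - u) ^ a₀ := Real.rpow_pos_of_pos hr _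
  have hq : 0 < (v - u) ^ (2 - δ) := Real.rpow_pos_of_pos hr _
  generalize (v / (v - u)) ^ (1 - δ) = A at *
  generalize ((-u) / (v - u)) ^ (1 - δ) = B at *
  generalize (v - u) ^ a₀ = s at *
  generalize (v - u) ^ (2 - δ) = q at *
  generalize (2 : ℝ) ^ (2 - δ + a₀ + a₀) = K at *
  have hw0 : 0 ≤ s⁻¹ * |x| := by positivity
  have hw : s⁻¹ * |x| ≤ C := by
    rw [inv_mul_le_iff₀ hs]; linarith
  have hxs : |x| = s * (s⁻¹ * |x|) := by field_simp
  generalize s⁻¹ * |x| = w at *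
  rw [hxs]
  have hAB : A * B ≤ 1 := mul_le_one₀ hA hB0 hB
  have hK : 0 ≤ K := le_trans (by positivity) hE
  calc A * q * B * s⁻¹ * (s * w) ^ 3 = (A * B) * ((q * s * s) * w) * w ^ 2 := by
        field_simp
    _ ≤ 1 * (K * C) * w ^ 2 := by gcongr
    _ = K * C * w ^ 2 := by ring
end
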